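/- Let G = ℝ^{n+1} be a Grushin space of homogeneous dimension Q = n+2 with Q ≥ 4. Let 1 < γ < ∞ and max{1, γ−1} < p < ∞. Then for all u ∈ C_0^∞(ℝ^{n+1}) and all R > 0: ( ∫_{ℝ^{n+1}} ϱ^{p−Q} |ln(R/ϱ)|^{p−γ} |∇_{ϱ,G} u|^p dx dt )^{1/p} ≥ ((γ−1)/p) ( ∫_{ℝ^{n+1}} |u(x,t) − u_R(x,t)|^p ψ^{p/2} / (ϱ^{Q} |ln(R/ϱ)|^{γ}) dx dt )^{1/p}, where u_R(x,t) = u(R x/ϱ(x,t), R^2 t/ϱ(x,t)^2). Moreover, the constant (γ−1)/p is sharp. -/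

import Mathlib

open MeasureTheory Real

noncomputable section

/-- Points of the Grushin space `ℝ^{n+1}`. -/
abbrev GPt (n : ℕ) := EuclideanSpace ℝ (Fin n) × ℝ

/-- Homogeneous Grushin norm `ϱ(x,t) = (|x|⁴ + 4t²)^{1/4}`. -/
def gNorm {n : ℕ} (z : GPt n) : ℝ := (‖z.1‖ ^ 4 + 4 * z.2 ^ 2) ^ ((1 : ℝ) / 4)

/-- The geometric term `ψ(x,t) = |x|²/ϱ²` (so that `|∇_G ϱ| = ψ^{1/2}`). -/
def gPsi {n : ℕ} (z : GPt n) : ℝ := ‖z.1‖ ^ 2 / gNorm z ^ 2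

/-- Radial derivative `∂_ϱ u(x,t) = d/ds u(s·x/ϱ, s²·t/ϱ²)` at `s = ϱ(x,t)`. -/
def radialDeriv {n : ℕ} (u : GPt n → ℝ) (z : GPt n) : ℝ :=
  deriv (fun s : ℝ => u ((s / gNorm z) • z.1, (s ^ 2 / gNorm z ^ 2) * z.2)) (gNorm z)

/-- The scaled function `u_R(x,t) = u(R·x/ϱ, R²·t/ϱ²)`. -/
def uScaled {n : ℕ} (R : ℝ) (u : GPt n → ℝ) (z : GPt n) : ℝ :=
  u ((R / gNorm z) • z.1, (R ^ 2 / gNorm z ^ 2) * z.2)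

/-- Radial Grushin operator `L_{ϱ,G} u = ψ(∂_ϱ² u + ((Q−1)/ϱ) ∂_ϱ u)`. -/
def radialLap {n : ℕ} (Q : ℝ) (u : GPt n → ℝ) (z : GPt n) : ℝ :=
  gPsi z * (radialDeriv (radialDeriv u) z + (Q - 1) / gNorm z * radialDeriv u z)

/-- The Grushin operator `L_G u = Δ_x u + |x|² ∂_t² u`. -/
def grushinOp {n : ℕ} (u : GPt n → ℝ) (z : GPt n) : ℝ :=
  (∑ i : Fin n,
      deriv (deriv fun s : ℝ => u (z.1 + s • EuclideanSpace.single i (1 : ℝ), z.2)) 0)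
    + ‖z.1‖ ^ 2 * deriv (deriv fun s : ℝ => u (z.1, z.2 + s)) 0

/-- The first-order operator `T_β(u) = ψ^{1/2}(∂_ϱ u + ((Q−β−2)/(2ϱ)) u)`. -/
def Tweight {n : ℕ} (Q β : ℝ) (u : GPt n → ℝ) (z : GPt n) : ℝ :=
  Real.sqrt (gPsi z) * (radialDeriv u z + (Q - β - 2) / (2 * gNorm z) * u z)

/-- The iterated operator `R_{β,k} = T_β ∘ T_{β+2} ∘ ⋯ ∘ T_{β+2k}`. -/
def Rop {n : ℕ} (Q : ℝ) : ℕ → ℝ → (GPt n → ℝ) → GPt n → ℝ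
  | 0, β, u => Tweight Q β u
  | k + 1, β, u => Tweight Q β (Rop Q k (β + 2) u)

/-- The constants `Λ_k(Q,p,β)`. -/
def Lam (Q p β : ℝ) (k : ℕ) : ℝ :=
  if k = 1 then ((Q - p - β) / p) ^ p
  else ((Q * (p - 1) + β + ((k : ℝ) - 2) * p) * (Q - β - (k : ℝ) * p) / p ^ 2) ^ p

/-- The constant `C_{2l,p,β} = ∏_{i=1}^{l} Λ_{2i}(Q,p,β)`. -/
def Ceven (Q p β : ℝ) (l : ℕ) : ℝ := ∏ i ∈ Finset.range l, Lam Q p β (2 * i + 2)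

/-- The constant `C_{2l+1,p,β} = ∏_{i=0}^{l} Λ_{2i+1}(Q,p,β)`. -/
def Codd (Q p β : ℝ) (l : ℕ) : ℝ := ∏ i ∈ Finset.range (l + 1), Lam Q p β (2 * i + 1)

/-- The constant `A_m = ((Q+m)² + (Q−4−m)²)/4`. -/
def Aconst (Q m : ℝ) : ℝ := ((Q + m) ^ 2 + (Q - 4 - m) ^ 2) / 4

/-- The constants `D_{j,m,β}` given by the iteration
`D_{j,m+1,β} = Λ_{2m+2}(Q,2,β) D_{j−2,m,β} + A_{β+4m} D_{j−1,m,β} + D_{j,m,β}`,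
with `D_{0,0,β} = 1` (and vanishing off-range values). -/
def Dconst (Q β : ℝ) : ℕ → ℤ → ℝ
  | 0, j => if j = 0 then 1 else 0
  | m + 1, j =>
      Lam Q 2 β (2 * m + 2) * Dconst Q β m (j - 2)
        + Aconst Q (β + 4 * (m : ℝ)) * Dconst Q β m (j - 1) + Dconst Q β m j

/-- The constants `B_{j,m,β,k}` given by the iteration
`B_{j,m+1,β,k} = Λ_2(Q,2,β+2k+2) B_{j−2,m,β+4,k} + A_{β+2k+2} B_{j−1,m,β+2,k+1} + B_{j,m,β,k+2}`,
with `B_{0,0,β,k} = 1` (and vanishing off-range values). -/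
def Bconst (Q : ℝ) : ℕ → ℤ → ℝ → ℝ → ℝ
  | 0, j, _, _ => if j = 0 then 1 else 0
  | m + 1, j, β, k =>
      Lam Q 2 (β + 2 * k + 2) 2 * Bconst Q m (j - 2) (β + 4) k
        + Aconst Q (β + 2 * k + 2) * Bconst Q m (j - 1) (β + 2) (k + 1)
        + Bconst Q m j β (k + 2)

/-- Surface measure `ω_n` of the unit sphere in `ℝ^n`. -/
def sphSurface (n : ℕ) : ℝ :=
  n * (volume (Metric.ball (0 : EuclideanSpace ℝ (Fin n)) 1)).toReal

/-- The integral constant `C^{Ω,m} = ω_n ∫_0^π (sin φ)^{(n+m)/2} dφ`. -/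
def COmega (n m : ℕ) : ℝ :=
  sphSurface n * ∫ φ in (0 : ℝ)..π, Real.sin φ ^ (((n : ℝ) + (m : ℝ)) / 2)

/-- The sharp Frank–Seiringer constant `c_p = min_{0<t≤1/2} [(1−t)^p − t^p + p t^{p−1}]`. -/
def cFS (p : ℝ) : ℝ :=
  sInf {y : ℝ | ∃ t : ℝ, 0 < t ∧ t ≤ 1 / 2 ∧ y = (1 - t) ^ p - t ^ p + p * t ^ (p - 1)}

/-- Compactly supported smooth test functions with (closed) support inside `s`. -/
def IsTest {n : ℕ} (s : Set (GPt n)) (u : GPt n → ℝ) : Prop :=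
  ContDiff ℝ (⊤ : ℕ∞) u ∧ HasCompactSupport u ∧ tsupport u ⊆ s

/-- A function on the Grushin space is radial if it depends only on the homogeneous norm. -/
def IsRadial {n : ℕ} (u : GPt n → ℝ) : Prop :=
  ∃ f : ℝ → ℝ, ∀ z, u z = f (gNorm z)

/-- The distance function `d_H(u,R)`. -/
def dH {n : ℕ} (Q p β R : ℝ) (u : GPt n → ℝ) : ℝ :=
  (∫ z : GPt n,
      |u z - R ^ ((Q - p - β) / p) * uScaled R u z * gNorm z ^ (-((Q - p - β) / p))| ^ p *
        gPsi z ^ (p / 2) / (|Real.log (R / gNorm z)| ^ p * gNorm z ^ (p + β))) ^ (1 / p)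

/-- The distance function `d_R(u,k,β)`. -/
def dRdist {n : ℕ} (Q p β R : ℝ) (k : ℕ) (u : GPt n → ℝ) : ℝ :=
  (∫ z : GPt n,
      (|u z| ^ ((p - 2) / 2) * u z -
          |uScaled R u z| ^ ((p - 2) / 2) * uScaled R u z *
            (gNorm z / R) ^ (-((Q - (k : ℝ) * p - β) / 2))) ^ 2 *
        gPsi z ^ (p / 2) /
        (gNorm z ^ ((k : ℝ) * p + β) * Real.log (R / gNorm z) ^ 2)) ^ ((1 : ℝ) / 2)

/-- The distance function `d_C(u,R)`. -/
def dCdist {n : ℕ} (Q p R : ℝ) (u : GPt n → ℝ) : ℝ :=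
  (∫ z in {z : GPt n | gNorm z < 1},
      |u z - Real.log (1 / gNorm z) ^ ((p - 1) / p) * R ^ ((p - 1) / p) *
          uScaled (Real.exp (-1 / R)) u z| ^ p *
        gPsi z ^ (p / 2) /
        (gNorm z ^ Q * Real.log (1 / gNorm z) ^ p *
          |Real.log (R * Real.log (1 / gNorm z))| ^ p)) ^ (1 / p)


/-- Hölder bound for `|F t| ^ p` by a power-weighted integral of `|F'| ^ p` over `(0, t]`. -/
lemma abs_rpow_le_lintegral_of_hasDerivAt {F F' : ℝ → ℝ} (hd : ∀ t, HasDerivAt F (F' t) t)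
    (hc : Continuous F') (h0 : F 0 = 0) {p c : ℝ} (hp : 1 < p) (hc0 : 0 < c) {t : ℝ} (ht : 0 < t) :
    ENNReal.ofReal (|F t| ^ p) ≤
      (∫⁻ s in Set.Ioc 0 t, ENNReal.ofReal (s ^ ((1 - c) * (p - 1)) * |F' s| ^ p)) *
        ENNReal.ofReal ((t ^ c / c) ^ (p - 1)) := by
  have hp0 : 0 < p := by linarith
  have hq := Real.HolderConjugate.conjExponent hp
  set q := p.conjExponent with hqdef
  have hqe : q = p / (p - 1) := rfl
  have hp1 : p - 1 ≠ 0 := by linarith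
  set α := (1 - c) * (p - 1) / p with hα
  have hFt : F t = ∫ s in Set.Ioc 0 t, F' s := by
    rw [← intervalIntegral.integral_of_le ht.le,
      intervalIntegral.integral_eq_sub_of_hasDerivAt (fun x _ => hd x)
        (hc.intervalIntegrable _ _), h0, sub_zero]
  have h1 : ENNReal.ofReal |F t| ≤ ∫⁻ s in Set.Ioc 0 t, ENNReal.ofReal |F' s| := by
    have := enorm_integral_le_lintegral_enorm (μ := volume.restrict (Set.Ioc 0 t)) F'
    rw [← hFt] at this
    simpa only [Real.enorm_eq_ofReal_abs] using this
  have h2 : ∫⁻ s in Set.Ioc 0 t, ENNReal.ofReal |F' s| =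
      ∫⁻ s in Set.Ioc 0 t, ((fun s => ENNReal.ofReal (s ^ α * |F' s|)) *
        fun s => ENNReal.ofReal (s ^ (-α))) s := by
    refine setLIntegral_congr_fun measurableSet_Ioc fun s hs => ?_
    simp only [Pi.mul_apply]
    have hs0 : 0 < s := hs.1
    rw [← ENNReal.ofReal_mul (by positivity)]
    congr 1
    rw [mul_right_comm, ← Real.rpow_add hs0]
    simp
  have h3 := ENNReal.lintegral_mul_le_Lp_mul_Lq (volume.restrict (Set.Ioc 0 t)) hq
    (f := fun s => ENNReal.ofReal (s ^ α * |F' s|)) (g := fun s => ENNReal.ofReal (s ^ (-α)))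
    (by fun_prop) (by fun_prop)
  have h4 : ∫⁻ s in Set.Ioc 0 t, ENNReal.ofReal (s ^ (-α)) ^ q = ENNReal.ofReal (t ^ c / c) := by
    have e1 : ∫⁻ s in Set.Ioc 0 t, ENNReal.ofReal (s ^ (-α)) ^ q =
        ∫⁻ s in Set.Ioc 0 t, ENNReal.ofReal (s ^ (c - 1)) := by
      refine setLIntegral_congr_fun measurableSet_Ioc fun s hs => ?_
      have hs0 : 0 < s := hs.1
      rw [ENNReal.ofReal_rpow_of_nonneg (by positivity) hq.symm.nonneg, ← Real.rpow_mul hs0.le]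
      congr 2
      rw [hα, hqe]
      field_simp
      ring
    have hii := intervalIntegral.intervalIntegrable_rpow' (a := 0) (b := t) (r := c - 1)
      (by linarith)
    rw [e1, ← ofReal_integral_eq_lintegral_ofReal
      ((intervalIntegrable_iff_integrableOn_Ioc_of_le ht.le).1 hii)
      ((ae_restrict_iff' measurableSet_Ioc).2 (ae_of_all _ fun s hs => by
        have hs0 : 0 < s := hs.1
        simp only [Pi.zero_apply]; positivity)),
      ← intervalIntegral.integral_of_le ht.le, integral_rpow (Or.inl (by linarith))]
    simp [Real.zero_rpow hc0.ne']
  have h5 : ∫⁻ s in Set.Ioc 0 t, ENNReal.ofReal (s ^ α * |F' s|) ^ p =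
      ∫⁻ s in Set.Ioc 0 t, ENNReal.ofReal (s ^ ((1 - c) * (p - 1)) * |F' s| ^ p) := by
    refine setLIntegral_congr_fun measurableSet_Ioc fun s hs => ?_
    have hs0 : 0 < s := hs.1
    rw [ENNReal.ofReal_rpow_of_nonneg (by positivity) hp0.le,
      Real.mul_rpow (by positivity) (abs_nonneg _), ← Real.rpow_mul hs0.le]
    congr 3
    rw [hα]
    field_simp
  rw [h4, h5] at h3
  have h6 := h1.trans (h2.le.trans h3)
  rw [← ENNReal.ofReal_rpow_of_nonneg (abs_nonneg _) hp0.le]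
  refine (ENNReal.rpow_le_rpow h6 hp0.le).trans_eq ?_
  rw [ENNReal.mul_rpow_of_nonneg _ _ hp0.le, ← ENNReal.rpow_mul, ← ENNReal.rpow_mul,
    ENNReal.ofReal_rpow_of_nonneg (by positivity) (by
      have := hq.symm.pos; positivity)]
  congr 2
  · rw [one_div_mul_cancel hp0.ne', ENNReal.rpow_one]
  · congr 1
    rw [hqe]; field_simp

/-- One-dimensional weighted Hardy inequality on the half line. -/
lemma lintegral_Ioi_hardy {F F' : ℝ → ℝ} (hd : ∀ t, HasDerivAt F (F' t) t)
    (hc : Continuous F') (h0 : F 0 = 0) {p γ : ℝ} (hp : 1 < p) (hγ : 1 < γ) :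
    ∫⁻ t in Set.Ioi 0, ENNReal.ofReal (|t| ^ (-γ) * |F t| ^ p) ≤
      ENNReal.ofReal ((p / (γ - 1)) ^ p) *
        ∫⁻ t in Set.Ioi 0, ENNReal.ofReal (|t| ^ (p - γ) * |F' t| ^ p) := by
  have hp0 : 0 < p := by linarith
  set c := (γ - 1) / p with hcdef
  have hc0 : 0 < c := div_pos (by linarith) hp0
  have hγc : γ = 1 + c * p := by rw [hcdef]; field_simp; ring
  set h : ℝ → ENNReal := fun s => ENNReal.ofReal (s ^ ((1 - c) * (p - 1)) * |F' s| ^ p) with hh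
  have hhm : Measurable h := by fun_prop
  set k : ℝ → ENNReal := fun t => ENNReal.ofReal (c ^ (-(p - 1)) * t ^ (-1 - c)) with hk
  have hkm : Measurable k := by fun_prop
  have hFk : ∀ t ∈ Set.Ioi (0 : ℝ), ENNReal.ofReal (|t| ^ (-γ) * |F t| ^ p) ≤
      ∫⁻ s in Set.Ioi 0, {x : ℝ × ℝ | x.2 ≤ x.1}.indicator (fun x => h x.2 * k x.1) (t, s) := by
    intro t ht
    have ht0 : 0 < t := ht
    have e : ∫⁻ s in Set.Ioi 0, {x : ℝ × ℝ | x.2 ≤ x.1}.indicator (fun x => h x.2 * k x.1) (t, s)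
        = (∫⁻ s in Set.Ioc 0 t, h s) * k t := by
      rw [← lintegral_mul_const _ hhm, ← Set.Ioi_inter_Iic, Set.inter_comm,
        ← Measure.restrict_restrict measurableSet_Iic, ← lintegral_indicator measurableSet_Iic]
      rfl
    rw [e, ENNReal.ofReal_mul (by positivity), abs_of_pos ht0, mul_comm]
    refine (mul_le_mul_left (abs_rpow_le_lintegral_of_hasDerivAt hd hc h0 hp hc0 ht0) _).trans_eq ?_
    rw [mul_assoc, ← ENNReal.ofReal_mul (by positivity)]
    congr 2
    rw [Real.div_rpow (by positivity) hc0.le, ← Real.rpow_mul ht0.le, Real.rpow_neg hc0.le,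
      div_mul_eq_mul_div, ← Real.rpow_add ht0, div_eq_inv_mul]
    congr 2
    rw [hγc]; ring
  have hks : ∀ s ∈ Set.Ioi (0 : ℝ),
      ∫⁻ t in Set.Ioi 0, {x : ℝ × ℝ | x.2 ≤ x.1}.indicator (fun x => h x.2 * k x.1) (t, s) =
        ENNReal.ofReal ((p / (γ - 1)) ^ p) * ENNReal.ofReal (|s| ^ (p - γ) * |F' s| ^ p) := by
    intro s hs
    have hs0 : 0 < s := hs
    have e : ∫⁻ t in Set.Ioi 0, {x : ℝ × ℝ | x.2 ≤ x.1}.indicator (fun x => h x.2 * k x.1) (t, s)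
        = h s * ∫⁻ t in Set.Ioi s, k t := by
      rw [← lintegral_const_mul _ hkm, setLIntegral_congr (Ioi_ae_eq_Ici (a := s)),
        ← Set.inter_eq_left.2 (Set.Ici_subset_Ioi.2 hs0),
        ← Measure.restrict_restrict measurableSet_Ici, ← lintegral_indicator measurableSet_Ici]
      rfl
    have e2 : ∫⁻ t in Set.Ioi s, k t = ENNReal.ofReal (c ^ (-p) * s ^ (-c)) := by
      have hi := integrableOn_Ioi_rpow_of_lt (a := -1 - c) (by linarith) hs0
      rw [hk, ← ofReal_integral_eq_lintegral_ofReal (hi.const_mul _)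
        ((ae_restrict_iff' measurableSet_Ioi).2 (ae_of_all _ fun t ht => by
          have ht0 : 0 < t := hs0.trans ht
          simp only [Pi.zero_apply]; positivity)), integral_const_mul,
        integral_Ioi_rpow_of_lt (by linarith) hs0]
      congr 1
      have : c ^ (-p) = c ^ (-(p - 1)) * c⁻¹ := by
        rw [← Real.rpow_neg_one c, ← Real.rpow_add hc0]; congr 1; ring
      rw [this, show -1 - c + 1 = -c by ring]
      field_simp
    rw [e, e2, hh, ← ENNReal.ofReal_mul (by positivity), ← ENNReal.ofReal_mul (by
      have : 0 < γ - 1 := by linarith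
      positivity), abs_of_pos hs0]
    congr 1
    rw [show p / (γ - 1) = c⁻¹ by rw [hcdef, inv_div], Real.inv_rpow hc0.le, ← Real.rpow_neg hc0.le,
      show p - γ = (1 - c) * (p - 1) + -c by rw [hγc]; ring, Real.rpow_add hs0]
    ring
  calc _ ≤ ∫⁻ t in Set.Ioi 0, ∫⁻ s in Set.Ioi 0,
        {x : ℝ × ℝ | x.2 ≤ x.1}.indicator (fun x => h x.2 * k x.1) (t, s) :=
        setLIntegral_mono' measurableSet_Ioi hFk
    _ = ∫⁻ s in Set.Ioi 0, ∫⁻ t in Set.Ioi 0,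
        {x : ℝ × ℝ | x.2 ≤ x.1}.indicator (fun x => h x.2 * k x.1) (t, s) := by
        refine lintegral_lintegral_swap (Measurable.aemeasurable ?_)
        exact Measurable.indicator (by fun_prop)
          (measurableSet_le measurable_snd measurable_fst)
    _ = ∫⁻ s in Set.Ioi 0,
        ENNReal.ofReal ((p / (γ - 1)) ^ p) * ENNReal.ofReal (|s| ^ (p - γ) * |F' s| ^ p) :=
        setLIntegral_congr_fun measurableSet_Ioi hks
    _ = _ := lintegral_const_mul _ (by fun_prop)

lemma lintegral_eq_Ioi_add_Ioi_neg (f : ℝ → ENNReal) :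
    ∫⁻ t, f t = (∫⁻ t in Set.Ioi 0, f t) + ∫⁻ t in Set.Ioi 0, f (-t) := by
  have h : ∫⁻ t in Set.Ioi 0, f (-t) = ∫⁻ t in Set.Iio 0, f t := by
    have := (Measure.measurePreserving_neg (volume : Measure ℝ)).setLIntegral_comp_preimage_emb
      (MeasurableEquiv.neg ℝ).measurableEmbedding f (Set.Iio 0)
    rw [← this]
    congr 2
    ext; simp
  rw [h, ← setLIntegral_congr Iio_ae_eq_Iic.symm, ← Set.compl_Ioi,
    lintegral_add_compl f measurableSet_Ioi]

/-- One-dimensional weighted Hardy inequality on the line. -/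
lemma lintegral_hardy {F F' : ℝ → ℝ} (hd : ∀ t, HasDerivAt F (F' t) t)
    (hc : Continuous F') (h0 : F 0 = 0) {p γ : ℝ} (hp : 1 < p) (hγ : 1 < γ) :
    ∫⁻ t, ENNReal.ofReal (|t| ^ (-γ) * |F t| ^ p) ≤
      ENNReal.ofReal ((p / (γ - 1)) ^ p) *
        ∫⁻ t, ENNReal.ofReal (|t| ^ (p - γ) * |F' t| ^ p) := by
  rw [lintegral_eq_Ioi_add_Ioi_neg, lintegral_eq_Ioi_add_Ioi_neg
    (fun t => ENNReal.ofReal (|t| ^ (p - γ) * |F' t| ^ p)), mul_add]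
  refine add_le_add (lintegral_Ioi_hardy hd hc h0 hp hγ) ?_
  have := lintegral_Ioi_hardy (F := fun t => F (-t)) (F' := fun t => -F' (-t))
    (fun t => by simpa [Function.comp_def] using (hd (-t)).scomp t (hasDerivAt_neg t)) (by fun_prop) (by simpa) hp hγ
  simpa only [abs_neg] using this

/-- The anisotropic dilation `δ_r (x, t) = (r x, r² t)`. -/
def gDil {n : ℕ} (r : ℝ) (z : GPt n) : GPt n := (r • z.1, r ^ 2 * z.2)

/-- The shell `1 ≤ ϱ < e`. -/
def gShell (n : ℕ) : Set (GPt n) := {z | 1 ≤ gNorm z ∧ gNorm z < exp 1}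

section geometry

variable {n : ℕ}

lemma gNorm_nonneg (z : GPt n) : 0 ≤ gNorm z := by unfold gNorm; positivity

lemma gNorm_pow_four (z : GPt n) : gNorm z ^ 4 = ‖z.1‖ ^ 4 + 4 * z.2 ^ 2 := by
  unfold gNorm
  rw [← Real.rpow_natCast, ← Real.rpow_mul (by positivity)]
  norm_num

lemma norm_fst_le_gNorm (z : GPt n) : ‖z.1‖ ≤ gNorm z := by
  refine le_of_pow_le_pow_left₀ (n := 4) (by norm_num) (gNorm_nonneg z) ?_
  rw [gNorm_pow_four]
  nlinarith [sq_nonneg z.2]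

lemma abs_snd_le_gNorm (z : GPt n) : 2 * |z.2| ≤ gNorm z ^ 2 := by
  refine abs_le_of_sq_le_sq' ?_ (sq_nonneg _) |>.2
  have := gNorm_pow_four z
  have h : 0 ≤ ‖z.1‖ ^ 4 := by positivity
  rw [mul_pow, sq_abs]
  nlinarith

lemma gNorm_pos {z : GPt n} (hz : z ≠ 0) : 0 < gNorm z := by
  refine (gNorm_nonneg z).lt_of_ne fun h => hz ?_
  have h1 := norm_fst_le_gNorm z
  have h2 := abs_snd_le_gNorm z
  rw [← h] at h1 h2
  have h3 : |z.2| ≤ 0 := by linarith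
  exact Prod.ext (norm_le_zero_iff.1 h1) (abs_nonpos_iff.1 h3)

lemma continuous_gNorm : Continuous (gNorm : GPt n → ℝ) := by
  unfold gNorm
  exact Continuous.rpow_const (by fun_prop) fun _ => Or.inr (by norm_num)

lemma measurable_gPsi : Measurable (gPsi : GPt n → ℝ) := by
  unfold gPsi
  have := (continuous_gNorm (n := n)).measurable
  fun_prop

lemma gPsi_nonneg (z : GPt n) : 0 ≤ gPsi z := by unfold gPsi; positivity

lemma gPsi_le_one (z : GPt n) : gPsi z ≤ 1 := by
  unfold gPsi
  exact div_le_one_of_le₀ (pow_le_pow_left₀ (norm_nonneg _) (norm_fst_le_gNorm z) 2) (sq_nonneg _)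

lemma gDil_gDil (r s : ℝ) (z : GPt n) : gDil r (gDil s z) = gDil (r * s) z := by
  simp [gDil, smul_smul, mul_pow, mul_assoc]

lemma gNorm_gDil {r : ℝ} (hr : 0 ≤ r) (z : GPt n) : gNorm (gDil r z) = r * gNorm z := by
  refine (pow_left_inj₀ (gNorm_nonneg _) (mul_nonneg hr (gNorm_nonneg _)) (n := 4) (by norm_num)).1 ?_
  rw [mul_pow, gNorm_pow_four, gNorm_pow_four]
  simp only [gDil, norm_smul, mul_pow, Real.norm_eq_abs, abs_of_nonneg hr]
  ring

lemma gPsi_gDil {r : ℝ} (hr : 0 < r) (z : GPt n) : gPsi (gDil r z) = gPsi z := by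
  unfold gPsi
  rw [gNorm_gDil hr.le]
  simp only [gDil, norm_smul, mul_pow, Real.norm_eq_abs, sq_abs]
  exact mul_div_mul_left _ _ (by positivity)

lemma continuous_gDil : Continuous fun x : ℝ × GPt n => gDil x.1 x.2 := by
  unfold gDil; fun_prop

lemma lintegral_gDil {r : ℝ} (hr : 0 < r) {F : GPt n → ENNReal} (hF : Measurable F) :
    ∫⁻ z, F (gDil r z) * ENNReal.ofReal (r ^ (n + 2)) = ∫⁻ z, F z := by
  have hm : Measurable (gDil r : GPt n → GPt n) :=
    (continuous_gDil.comp (Continuous.prodMk_right r)).measurable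
  have hmap : Measure.map (gDil r) (volume : Measure (GPt n)) =
      ENNReal.ofReal ((r ^ (n + 2))⁻¹) • volume := by
    have h1 := Measure.map_addHaar_smul (volume : Measure (EuclideanSpace ℝ (Fin n))) hr.ne'
    have h2 := Measure.map_addHaar_smul (volume : Measure ℝ) (pow_pos hr 2).ne'
    have h3 := Measure.map_prod_map (volume : Measure (EuclideanSpace ℝ (Fin n)))
      (volume : Measure ℝ) (measurable_const_smul r) (measurable_const_smul (r ^ 2))
    have h4 : (gDil r : GPt n → GPt n) = Prod.map (fun x => r • x) (fun t => r ^ 2 • t) := by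
      funext z; simp [gDil, Prod.map]
    rw [h4, Measure.volume_eq_prod, ← h3, h1, h2, Measure.prod_smul_left, Measure.prod_smul_right,
      smul_smul, ← ENNReal.ofReal_mul (by positivity)]
    congr 2
    rw [abs_of_pos (by positivity), abs_of_pos (by positivity)]
    simp only [finrank_euclideanSpace, Fintype.card_fin, Module.finrank_self, pow_one]
    rw [← mul_inv, ← pow_add]
  rw [lintegral_mul_const _ (show Measurable fun z => F (gDil r z) from hF.comp hm), ← lintegral_map hF hm, hmap, lintegral_smul_measure,
    smul_eq_mul, mul_comm, ← mul_assoc, ← ENNReal.ofReal_mul (by positivity),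
    mul_inv_cancel₀ (by positivity), ENNReal.ofReal_one, one_mul]

lemma measurableSet_gShell : MeasurableSet (gShell n) :=
  (measurableSet_le measurable_const continuous_gNorm.measurable).inter
    (measurableSet_lt continuous_gNorm.measurable measurable_const)

lemma gNorm_pos_of_mem_gShell {z : GPt n} (hz : z ∈ gShell n) : 0 < gNorm z :=
  zero_lt_one.trans_le hz.1

lemma isBounded_gNorm_le (M : ℝ) : Bornology.IsBounded {z : GPt n | gNorm z ≤ M} := by
  refine (Metric.isBounded_closedBall (x := (0 : GPt n)) (r := max M (M ^ 2))).subset fun z hz => ?_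
  have hz' : gNorm z ≤ M := hz
  have h1 := norm_fst_le_gNorm z
  have h2 := abs_snd_le_gNorm z
  have h3 : gNorm z ^ 2 ≤ M ^ 2 := pow_le_pow_left₀ (gNorm_nonneg z) hz' 2
  rw [mem_closedBall_zero_iff, Prod.norm_def, Real.norm_eq_abs]
  exact max_le_max (h1.trans hz') (by linarith [abs_nonneg z.2])

lemma volume_gShell_lt_top : volume (gShell n) < ⊤ :=
  ((isBounded_gNorm_le (exp 1)).subset fun _ hz => hz.2.le).measure_lt_top

/-- Integration in dilation-polar coordinates, with the shell `1 ≤ ϱ < e` as cross-section. -/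
lemma lintegral_polar {F : GPt n → ENNReal} (hF : Measurable F) {R : ℝ} (hR : 0 < R) :
    ∫⁻ z, F z = ∫⁻ z in gShell n, ∫⁻ t : ℝ, F (gDil (R * exp t / gNorm z) z) *
      ENNReal.ofReal ((R * exp t / gNorm z) ^ (n + 2)) := by
  have hshift : ∀ z ∈ gShell n, ∫⁻ t : ℝ, F (gDil (R * exp t / gNorm z) z) *
      ENNReal.ofReal ((R * exp t / gNorm z) ^ (n + 2)) =
      ∫⁻ t : ℝ, F (gDil (exp t) z) * ENNReal.ofReal (exp t ^ (n + 2)) := by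
    intro z hz
    rw [← lintegral_add_right_eq_self
      (fun t => F (gDil (exp t) z) * ENNReal.ofReal (exp t ^ (n + 2))) (Real.log (R / gNorm z))]
    refine lintegral_congr fun t => ?_
    have := gNorm_pos_of_mem_gShell hz
    rw [exp_add, exp_log (by positivity), mul_div_assoc', mul_comm R]
  have hslice : ∀ z : GPt n, z ≠ 0 →
      ∫⁻ t : ℝ, (gShell n).indicator 1 (gDil (exp (-t)) z) = (1 : ENNReal) := by
    intro z hz
    have hz0 := gNorm_pos hz
    have : ∀ t : ℝ, (gShell n).indicator (1 : GPt n → ENNReal) (gDil (exp (-t)) z) =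
        (Set.Ioc (Real.log (gNorm z) - 1) (Real.log (gNorm z))).indicator 1 t := by
      intro t
      have hiff : gDil (exp (-t)) z ∈ gShell n ↔
          t ∈ Set.Ioc (Real.log (gNorm z) - 1) (Real.log (gNorm z)) := by
        simp only [gShell, Set.mem_ofPred_eq, gNorm_gDil (exp_pos _).le, Set.mem_Ioc]
        rw [← exp_log hz0, ← exp_add, one_le_exp_iff, exp_lt_exp, log_exp]
        constructor <;> rintro ⟨h1, h2⟩ <;> constructor <;> linarith
      by_cases h : t ∈ Set.Ioc (Real.log (gNorm z) - 1) (Real.log (gNorm z))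
      · rw [Set.indicator_of_mem h, Set.indicator_of_mem (hiff.2 h)]; rfl
      · rw [Set.indicator_of_notMem h, Set.indicator_of_notMem (mt hiff.1 h)]
    simp_rw [this]
    rw [lintegral_indicator_one measurableSet_Ioc, Real.volume_Ioc]
    simp
  have hdil : Measurable fun x : GPt n × ℝ => gDil (exp (-x.2)) x.1 :=
    (continuous_gDil.comp (by fun_prop : Continuous fun x : GPt n × ℝ =>
      (exp (-x.2), x.1))).measurable
  have hdil' : Measurable fun x : ℝ × GPt n => gDil (exp x.1) x.2 :=
    (continuous_gDil.comp (by fun_prop : Continuous fun x : ℝ × GPt n =>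
      (exp x.1, x.2))).measurable
  have hind : Measurable ((gShell n).indicator (1 : GPt n → ENNReal)) :=
    measurable_one.indicator measurableSet_gShell
  calc ∫⁻ z, F z = ∫⁻ z, ∫⁻ t : ℝ, F z * (gShell n).indicator 1 (gDil (exp (-t)) z) := by
        refine lintegral_congr_ae ?_
        have : ∀ᵐ z : GPt n, z ≠ 0 := by
          rw [ae_iff]
          have h0 : ({a | ¬a ≠ 0} : Set (GPt n)) = {0} ×ˢ {0} := by
            ext z; simp [Prod.ext_iff]
          rw [h0, Measure.volume_eq_prod, Measure.prod_prod]
          simp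
        filter_upwards [this] with z hz
        rw [lintegral_const_mul _ (show Measurable fun t : ℝ =>
          (gShell n).indicator (1 : GPt n → ENNReal) (gDil (exp (-t)) z) from
            hind.comp (hdil.comp measurable_prodMk_left)), hslice z hz,
          mul_one]
    _ = ∫⁻ t : ℝ, ∫⁻ z, F z * (gShell n).indicator 1 (gDil (exp (-t)) z) :=
        lintegral_lintegral_swap
          ((hF.comp measurable_fst).mul (hind.comp hdil)).aemeasurable
    _ = ∫⁻ t : ℝ, ∫⁻ z, (F (gDil (exp t) z) * ENNReal.ofReal (exp t ^ (n + 2))) *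
          (gShell n).indicator 1 z := by
        refine lintegral_congr fun t => ?_
        rw [← lintegral_gDil (exp_pos t) (show Measurable fun z =>
          F z * (gShell n).indicator 1 (gDil (exp (-t)) z) from
            hF.mul (hind.comp (hdil.comp (measurable_prodMk_right (y := t)))))]
        refine lintegral_congr fun z => ?_
        simp only [gDil_gDil]
        rw [← exp_add, neg_add_cancel, exp_zero]
        have : gDil 1 z = z := by simp [gDil]
        rw [this, mul_right_comm]
    _ = ∫⁻ z, ∫⁻ t : ℝ, (F (gDil (exp t) z) * ENNReal.ofReal (exp t ^ (n + 2))) *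
          (gShell n).indicator 1 z := by
        refine lintegral_lintegral_swap (Measurable.aemeasurable ?_)
        exact ((hF.comp hdil').mul (by fun_prop)).mul (hind.comp measurable_snd)
    _ = _ := by
        rw [← lintegral_indicator measurableSet_gShell]
        refine lintegral_congr fun z => ?_
        by_cases hz : z ∈ gShell n
        · simp only [Set.indicator_of_mem hz, hshift z hz, Pi.one_apply, mul_one]
        · simp [Set.indicator_of_notMem hz]

end geometry

section estimates

variable {n : ℕ}

/-- The gradient-side integrand of the Hardy inequality. -/
def hardyGradIntegrand (Q γ p R : ℝ) (u : GPt n → ℝ) (z : GPt n) : ℝ :=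
  gNorm z ^ (p - Q) * |Real.log (R / gNorm z)| ^ (p - γ) *
    (gPsi z ^ (p / 2) * |radialDeriv u z| ^ p)

/-- The difference-side integrand of the Hardy inequality. -/
def hardyDiffIntegrand (Q γ p R : ℝ) (u : GPt n → ℝ) (z : GPt n) : ℝ :=
  |u z - uScaled R u z| ^ p * gPsi z ^ (p / 2) /
    (gNorm z ^ Q * |Real.log (R / gNorm z)| ^ γ)

/-- The restriction of `u` to the dilation orbit of `z`, normalized to have `ϱ = R` at time `0`. -/
def ray (R : ℝ) (u : GPt n → ℝ) (z : GPt n) (t : ℝ) : ℝ := u (gDil (R * exp t / gNorm z) z)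

lemma uScaled_eq (R : ℝ) (u : GPt n → ℝ) (z : GPt n) :
    uScaled R u z = u (gDil (R / gNorm z) z) := by
  simp [uScaled, gDil, div_pow]

lemma radialDeriv_eq (u : GPt n → ℝ) (z : GPt n) :
    radialDeriv u z = deriv (fun s => u (gDil (s / gNorm z) z)) (gNorm z) := by
  simp [radialDeriv, gDil, div_pow]

lemma contDiff_gDil_div (ρ : ℝ) (z : GPt n) :
    ContDiff ℝ (⊤ : ℕ∞) fun s : ℝ => gDil (s / ρ) z := by
  unfold gDil; fun_prop

lemma gDil_self_div (z : GPt n) : gDil (gNorm z / gNorm z) z = z := by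
  by_cases hz : z = 0
  · simp [hz, gDil]
  · rw [div_self (gNorm_pos hz).ne']; simp [gDil]

lemma radialDeriv_eq_fderiv {u : GPt n → ℝ} (hu : ContDiff ℝ (⊤ : ℕ∞) u) (z : GPt n) :
    radialDeriv u z = fderiv ℝ u z ((1 / gNorm z) • z.1, 2 / gNorm z * z.2) := by
  rw [radialDeriv_eq]
  have h1 : HasDerivAt (fun s : ℝ => gDil (s / gNorm z) z)
      ((1 / gNorm z) • z.1, 2 / gNorm z * z.2) (gNorm z) := by
    have ha : HasDerivAt (fun s : ℝ => (s / gNorm z) • z.1) ((1 / gNorm z) • z.1) (gNorm z) :=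
      ((hasDerivAt_id _).div_const _).smul_const _
    have hb : HasDerivAt (fun s : ℝ => (s / gNorm z) ^ 2 * z.2) (2 / gNorm z * z.2)
        (gNorm z) := by
      refine (((hasDerivAt_id _).div_const _).pow 2 |>.mul_const _).congr_deriv ?_
      by_cases hz : gNorm z = 0
      · simp [hz]
      · simp [hz, div_eq_mul_inv]
    exact ha.prodMk hb
  have h2 : HasFDerivAt u (fderiv ℝ u z) (gDil (gNorm z / gNorm z) z) := by
    rw [gDil_self_div]
    exact (hu.differentiable (by simp) z).hasFDerivAt
  exact (HasFDerivAt.comp_hasDerivAt (f := fun s => gDil (s / gNorm z) z) (gNorm z) h2 h1).deriv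

lemma measurable_radialDeriv {u : GPt n → ℝ} (hu : ContDiff ℝ (⊤ : ℕ∞) u) :
    Measurable (radialDeriv u) := by
  have h : radialDeriv u = fun z => fderiv ℝ u z ((1 / gNorm z) • z.1, 2 / gNorm z * z.2) :=
    funext (radialDeriv_eq_fderiv hu)
  rw [h]
  have h1 : Continuous fun x : GPt n × GPt n => fderiv ℝ u x.1 x.2 :=
    ((hu.continuous_fderiv (by simp)).comp continuous_fst).clm_apply continuous_snd
  have h2 := (continuous_gNorm (n := n)).measurable
  exact h1.measurable.comp (measurable_id.prodMk (by fun_prop))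

lemma measurable_uScaled (R : ℝ) {u : GPt n → ℝ} (hu : Continuous u) :
    Measurable (uScaled R u) := by
  have h : uScaled R u = fun z => u (gDil (R / gNorm z) z) := funext (uScaled_eq R u)
  rw [h]
  have h2 := (continuous_gNorm (n := n)).measurable
  exact hu.measurable.comp (continuous_gDil.measurable.comp
    (by fun_prop : Measurable fun z : GPt n => (R / gNorm z, z)))

lemma measurable_hardyGradIntegrand (Q γ p R : ℝ) {u : GPt n → ℝ} (hu : ContDiff ℝ (⊤ : ℕ∞) u) :
    Measurable (hardyGradIntegrand Q γ p R u) := by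
  have h1 := (continuous_gNorm (n := n)).measurable
  have h2 := measurable_gPsi (n := n)
  have h3 := measurable_radialDeriv hu
  unfold hardyGradIntegrand
  fun_prop

lemma measurable_hardyDiffIntegrand (Q γ p R : ℝ) {u : GPt n → ℝ} (hu : Continuous u) :
    Measurable (hardyDiffIntegrand Q γ p R u) := by
  have h1 := (continuous_gNorm (n := n)).measurable
  have h2 := measurable_gPsi (n := n)
  have h3 := measurable_uScaled R hu
  have h4 := hu.measurable
  unfold hardyDiffIntegrand
  fun_prop

lemma hardyGradIntegrand_nonneg (Q γ p R : ℝ) (u : GPt n → ℝ) (z : GPt n) :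
    0 ≤ hardyGradIntegrand Q γ p R u z := by
  have h1 := gNorm_nonneg z
  have h2 := gPsi_nonneg z
  unfold hardyGradIntegrand
  positivity

lemma hardyDiffIntegrand_nonneg (Q γ p R : ℝ) (u : GPt n → ℝ) (z : GPt n) :
    0 ≤ hardyDiffIntegrand Q γ p R u z := by
  have h1 := gNorm_nonneg z
  have h2 := gPsi_nonneg z
  unfold hardyDiffIntegrand
  positivity

lemma contDiff_ray (R : ℝ) {u : GPt n → ℝ} (hu : ContDiff ℝ (⊤ : ℕ∞) u) (z : GPt n) :
    ContDiff ℝ (⊤ : ℕ∞) (ray R u z) := by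
  unfold ray
  exact hu.comp ((contDiff_gDil_div (gNorm z) z).comp (contDiff_const.mul contDiff_exp))

lemma deriv_ray {R : ℝ} (hR : 0 < R) {u : GPt n → ℝ} (hu : ContDiff ℝ (⊤ : ℕ∞) u) {z : GPt n}
    (hz : 0 < gNorm z) (t : ℝ) :
    deriv (ray R u z) t = R * exp t * radialDeriv u (gDil (R * exp t / gNorm z) z) := by
  have hRt : 0 < R * exp t := by positivity
  have hd : Differentiable ℝ fun s => u (gDil (s / gNorm z) z) :=
    (hu.comp (contDiff_gDil_div (gNorm z) z)).differentiable (by simp)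
  have h1 : radialDeriv u (gDil (R * exp t / gNorm z) z) =
      deriv (fun s => u (gDil (s / gNorm z) z)) (R * exp t) := by
    rw [radialDeriv_eq, gNorm_gDil (by positivity), div_mul_cancel₀ _ hz.ne']
    congr 1
    funext s
    rw [gDil_gDil, div_mul_div_cancel₀ hRt.ne']
  rw [h1, mul_comm]
  exact ((hd (R * exp t)).hasDerivAt.comp t ((hasDerivAt_exp t).const_mul R)).deriv

lemma log_div_gNorm_ray {R : ℝ} (hR : 0 < R) {z : GPt n} (hz : 0 < gNorm z) (t : ℝ) :
    Real.log (R / gNorm (gDil (R * exp t / gNorm z) z)) = -t := by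
  rw [gNorm_gDil (by positivity), div_mul_cancel₀ _ hz.ne', div_mul_cancel_left₀ hR.ne',
    ← exp_neg, log_exp]

lemma lintegral_hardyGradIntegrand (γ p : ℝ) {R : ℝ} (hR : 0 < R) {u : GPt n → ℝ}
    (hu : ContDiff ℝ (⊤ : ℕ∞) u) :
    ∫⁻ z, ENNReal.ofReal (hardyGradIntegrand (n + 2) γ p R u z) =
      ∫⁻ z in gShell n, ENNReal.ofReal (gPsi z ^ (p / 2) / gNorm z ^ (n + 2)) *
        ∫⁻ t, ENNReal.ofReal (|t| ^ (p - γ) * |deriv (ray R u z) t| ^ p) := by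
  rw [lintegral_polar (measurable_hardyGradIntegrand _ γ p R hu).ennreal_ofReal hR]
  refine setLIntegral_congr_fun measurableSet_gShell fun z hz => ?_
  have hz0 := gNorm_pos_of_mem_gShell hz
  have hψ := gPsi_nonneg z
  rw [← lintegral_const_mul' _ _ ENNReal.ofReal_ne_top]
  refine lintegral_congr fun t => ?_
  have hr : 0 < R * exp t / gNorm z := by positivity
  rw [← ENNReal.ofReal_mul (hardyGradIntegrand_nonneg _ _ _ _ _ _),
    ← ENNReal.ofReal_mul (by positivity), deriv_ray hR hu hz0, hardyGradIntegrand,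
    log_div_gNorm_ray hR hz0, gPsi_gDil hr, abs_neg, gNorm_gDil hr.le,
    div_mul_cancel₀ _ hz0.ne', abs_mul, Real.mul_rpow (abs_nonneg _) (abs_nonneg _),
    abs_of_pos (by positivity : 0 < R * exp t), Real.rpow_sub (by positivity),
    show (n + 2 : ℝ) = ((n + 2 : ℕ) : ℝ) by push_cast; ring, Real.rpow_natCast, div_pow]
  congr 1
  have : (R * exp t) ^ (n + 2) ≠ 0 := by positivity
  field_simp

lemma lintegral_hardyDiffIntegrand (γ p : ℝ) {R : ℝ} (hR : 0 < R) {u : GPt n → ℝ}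
    (hu : Continuous u) :
    ∫⁻ z, ENNReal.ofReal (hardyDiffIntegrand (n + 2) γ p R u z) =
      ∫⁻ z in gShell n, ENNReal.ofReal (gPsi z ^ (p / 2) / gNorm z ^ (n + 2)) *
        ∫⁻ t, ENNReal.ofReal (|t| ^ (-γ) * |ray R u z t - ray R u z 0| ^ p) := by
  rw [lintegral_polar (measurable_hardyDiffIntegrand _ γ p R hu).ennreal_ofReal hR]
  refine setLIntegral_congr_fun measurableSet_gShell fun z hz => ?_
  have hz0 := gNorm_pos_of_mem_gShell hz
  have hψ := gPsi_nonneg z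
  rw [← lintegral_const_mul' _ _ ENNReal.ofReal_ne_top]
  refine lintegral_congr fun t => ?_
  have hr : 0 < R * exp t / gNorm z := by positivity
  have hRt : 0 < R * exp t := by positivity
  have h0 : uScaled R u (gDil (R * exp t / gNorm z) z) = ray R u z 0 := by
    rw [uScaled_eq, gNorm_gDil hr.le, gDil_gDil, div_mul_cancel₀ _ hz0.ne',
      div_mul_div_cancel₀ hRt.ne', ray, exp_zero, mul_one]
  rw [← ENNReal.ofReal_mul (hardyDiffIntegrand_nonneg _ _ _ _ _ _),
    ← ENNReal.ofReal_mul (by positivity), hardyDiffIntegrand, h0,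
    log_div_gNorm_ray hR hz0, gPsi_gDil hr, abs_neg, gNorm_gDil hr.le,
    div_mul_cancel₀ _ hz0.ne', Real.rpow_neg (abs_nonneg t),
    show (n + 2 : ℝ) = ((n + 2 : ℕ) : ℝ) by push_cast; ring, Real.rpow_natCast, div_pow]
  congr 1
  rw [show u (gDil (R * exp t / gNorm z) z) = ray R u z t from rfl, div_mul_div_comm, mul_comm ((R * exp t) ^ (n + 2)) (|t| ^ γ), mul_assoc (|t| ^ γ),
    mul_comm ((R * exp t) ^ (n + 2)) (gNorm z ^ (n + 2)), ← mul_assoc (|t| ^ γ),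
    mul_div_mul_right _ _ (by positivity : (R * exp t) ^ (n + 2) ≠ 0)]
  simp only [div_eq_mul_inv, mul_inv]
  ring

lemma lintegral_hardyDiffIntegrand_le {γ p : ℝ} (hγ : 1 < γ) (hp : 1 < p) {R : ℝ} (hR : 0 < R)
    {u : GPt n → ℝ} (hu : ContDiff ℝ (⊤ : ℕ∞) u) :
    ∫⁻ z, ENNReal.ofReal (hardyDiffIntegrand (n + 2) γ p R u z) ≤
      ENNReal.ofReal ((p / (γ - 1)) ^ p) *
        ∫⁻ z, ENNReal.ofReal (hardyGradIntegrand (n + 2) γ p R u z) := by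
  rw [lintegral_hardyDiffIntegrand γ p hR hu.continuous, lintegral_hardyGradIntegrand γ p hR hu,
    ← lintegral_const_mul' _ _ ENNReal.ofReal_ne_top]
  refine setLIntegral_mono' measurableSet_gShell fun z _ => ?_
  rw [mul_left_comm]
  refine mul_le_mul_right ?_ _
  have hray := contDiff_ray R hu z
  exact lintegral_hardy (F := fun t => ray R u z t - ray R u z 0) (F' := deriv (ray R u z))
    (fun t => ((hray.differentiable (by simp) t).hasDerivAt.sub_const _))
    (hray.continuous_deriv (by simp)) (sub_self _) hp hγ

lemma exists_radialDeriv_bound {u : GPt n → ℝ} (hu : ContDiff ℝ (⊤ : ℕ∞) u)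
    (hs : HasCompactSupport u) :
    ∃ K M : ℝ, 0 ≤ K ∧ 0 < M ∧ (∀ z, |radialDeriv u z| ≤ K) ∧
      ∀ z, M < gNorm z → radialDeriv u z = 0 := by
  obtain ⟨M₀, hM₀⟩ := IsCompact.exists_bound_of_continuousOn hs
    (continuous_gNorm (n := n)).continuousOn
  obtain ⟨K₀, hK₀⟩ := (hs.fderiv ℝ).exists_bound_of_continuous (hu.continuous_fderiv (by simp))
  have hK₀0 : 0 ≤ K₀ := (norm_nonneg _).trans (hK₀ 0)
  have hM : 0 < max M₀ 1 := lt_max_of_lt_right one_pos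
  have hzero : ∀ z, max M₀ 1 < gNorm z → radialDeriv u z = 0 := by
    intro z hz
    have hzs : z ∉ tsupport u := fun h => by
      have := (le_abs_self _).trans (hM₀ z h)
      exact absurd (this.trans (le_max_left _ 1)) (not_le.2 hz)
    rw [radialDeriv_eq_fderiv hu, fderiv_of_notMem_tsupport _ hzs]
    rfl
  refine ⟨K₀ * (1 + max M₀ 1), max M₀ 1, by positivity, hM, fun z => ?_, hzero⟩
  by_cases hz : max M₀ 1 < gNorm z
  · rw [hzero z hz, abs_zero]; positivity
  · push Not at hz
    rw [radialDeriv_eq_fderiv hu, ← Real.norm_eq_abs]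
    refine (ContinuousLinearMap.le_opNorm _ _).trans (mul_le_mul (hK₀ z) ?_ (norm_nonneg _) hK₀0)
    have h0 := gNorm_nonneg z
    rw [Prod.norm_def]
    refine max_le ?_ ?_
    · rw [norm_smul, Real.norm_eq_abs, abs_of_nonneg (by positivity), one_div_mul_eq_div]
      exact (div_le_one_of_le₀ (norm_fst_le_gNorm z) h0).trans (by linarith)
    · rw [norm_mul, Real.norm_eq_abs, Real.norm_eq_abs, abs_of_nonneg (by positivity),
        div_mul_eq_mul_div]
      refine div_le_of_le_mul₀ h0 (by positivity) ((abs_snd_le_gNorm z).trans ?_)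
      nlinarith

lemma lintegral_hardyGradIntegrand_lt_top {γ p : ℝ} (hp : 1 < p) (hpγ : γ - 1 < p) {R : ℝ}
    (hR : 0 < R) {u : GPt n → ℝ} (hu : ContDiff ℝ (⊤ : ℕ∞) u) (hs : HasCompactSupport u) :
    ∫⁻ z, ENNReal.ofReal (hardyGradIntegrand (n + 2) γ p R u z) < ⊤ := by
  have hp0 : 0 < p := by linarith
  obtain ⟨K, M, hK, hM, hbound, hzero⟩ := exists_radialDeriv_bound hu hs
  set T := max 0 (Real.log (M / R)) with hT
  have hT0 : 0 ≤ T := le_max_left _ _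
  have hderiv : ∀ z ∈ gShell n, ∀ t, |deriv (ray R u z) t| ≤ R * exp t * K := by
    intro z hz t
    rw [deriv_ray hR hu (gNorm_pos_of_mem_gShell hz), abs_mul,
      abs_of_pos (by positivity : 0 < R * exp t)]
    exact mul_le_mul_of_nonneg_left (hbound _) (by positivity)
  have hderiv0 : ∀ z ∈ gShell n, ∀ t, T < t → deriv (ray R u z) t = 0 := by
    intro z hz t ht
    have hz0 := gNorm_pos_of_mem_gShell hz
    rw [deriv_ray hR hu hz0, hzero, mul_zero]
    rw [gNorm_gDil (by positivity), div_mul_cancel₀ _ hz0.ne', mul_comm, ← div_lt_iff₀ hR]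
    exact (Real.log_lt_iff_lt_exp (by positivity)).1 ((le_max_right _ _).trans_lt ht)
  set B₁ := ∫⁻ t in Set.Ioc 0 T, ENNReal.ofReal (t ^ (p - γ) * (R * exp T * K) ^ p) with hB₁def
  set B₂ := ∫⁻ t in Set.Ioi 0, ENNReal.ofReal (t ^ (p - γ) * exp (-p * t ^ (1 : ℝ)) * (R * K) ^ p)
  have hB₁ : B₁ < ⊤ := by
    have := intervalIntegral.intervalIntegrable_rpow' (a := 0) (b := T) (r := p - γ)
      (by linarith)
    exact (((intervalIntegrable_iff_integrableOn_Ioc_of_le hT0).1 this).mul_const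
      _).lintegral_lt_top
  have hB₂ : B₂ < ⊤ := by
    have := integrableOn_rpow_mul_exp_neg_mul_rpow (p := 1) (s := p - γ) (b := p) (by linarith)
      one_pos hp0
    exact (this.mul_const _).lintegral_lt_top
  have hinner : ∀ z ∈ gShell n,
      ∫⁻ t, ENNReal.ofReal (|t| ^ (p - γ) * |deriv (ray R u z) t| ^ p) ≤ B₁ + B₂ := by
    intro z hz
    rw [lintegral_eq_Ioi_add_Ioi_neg]
    refine add_le_add ?_ ?_
    · rw [← lintegral_indicator measurableSet_Ioi, hB₁def, ← lintegral_indicator measurableSet_Ioc]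
      refine lintegral_mono fun t => ?_
      refine Set.indicator_apply_le fun ht => ?_
      have ht0 : 0 < t := ht
      by_cases htT : t ≤ T
      · rw [Set.indicator_of_mem (show t ∈ Set.Ioc 0 T from ⟨ht, htT⟩), abs_of_pos ht0]
        refine ENNReal.ofReal_le_ofReal (mul_le_mul_of_nonneg_left ?_ (by positivity))
        refine Real.rpow_le_rpow (abs_nonneg _) ((hderiv z hz t).trans ?_) hp0.le
        gcongr
      · rw [hderiv0 z hz t (not_le.1 htT), abs_zero, Real.zero_rpow hp0.ne']
        simp
    · refine setLIntegral_mono' measurableSet_Ioi fun t ht => ENNReal.ofReal_le_ofReal ?_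
      have ht0 : 0 < t := ht
      rw [abs_neg, abs_of_pos ht0, mul_assoc]
      refine mul_le_mul_of_nonneg_left ?_ (by positivity)
      refine (Real.rpow_le_rpow (abs_nonneg _) (hderiv z hz (-t)) hp0.le).trans_eq ?_
      rw [mul_right_comm, Real.mul_rpow (by positivity) (by positivity), mul_comm, ← Real.exp_mul,
        Real.rpow_one]
      congr 2
      ring
  rw [lintegral_hardyGradIntegrand γ p hR hu]
  refine (setLIntegral_mono' measurableSet_gShell fun z hz =>
    (mul_le_mul' (b := 1) ?_ (hinner z hz)).trans_eq (one_mul _)).trans_lt ?_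
  · rw [ENNReal.ofReal_le_one]
    refine div_le_one_of_le₀ ?_ (pow_nonneg (gNorm_nonneg z) _)
    exact (Real.rpow_le_one (gPsi_nonneg z) (gPsi_le_one z) (by positivity)).trans
      (one_le_pow₀ hz.1)
  · rw [setLIntegral_const]
    exact ENNReal.mul_lt_top (ENNReal.add_lt_top.2 ⟨hB₁, hB₂⟩) volume_gShell_lt_top

lemma integral_hardyGradIntegrand (Q γ p R : ℝ) {u : GPt n → ℝ} (hu : ContDiff ℝ (⊤ : ℕ∞) u) :
    ∫ z, hardyGradIntegrand Q γ p R u z =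
      (∫⁻ z, ENNReal.ofReal (hardyGradIntegrand Q γ p R u z)).toReal :=
  integral_eq_lintegral_of_nonneg_ae (ae_of_all _ (hardyGradIntegrand_nonneg Q γ p R u))
    (measurable_hardyGradIntegrand Q γ p R hu).aestronglyMeasurable

lemma integral_hardyDiffIntegrand (Q γ p R : ℝ) {u : GPt n → ℝ} (hu : Continuous u) :
    ∫ z, hardyDiffIntegrand Q γ p R u z =
      (∫⁻ z, ENNReal.ofReal (hardyDiffIntegrand Q γ p R u z)).toReal :=
  integral_eq_lintegral_of_nonneg_ae (ae_of_all _ (hardyDiffIntegrand_nonneg Q γ p R u))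
    (measurable_hardyDiffIntegrand Q γ p R hu).aestronglyMeasurable

/-- The Hardy inequality for the difference of a function and its scaled version. -/
lemma hardy_diff_le {γ p : ℝ} (hγ : 1 < γ) (hp : 1 < p) (hpγ : γ - 1 < p) {R : ℝ}
    (hR : 0 < R) {u : GPt n → ℝ} (hu : ContDiff ℝ (⊤ : ℕ∞) u) (hs : HasCompactSupport u) :
    (γ - 1) / p * (∫ z, hardyDiffIntegrand (n + 2) γ p R u z) ^ (1 / p) ≤
      (∫ z, hardyGradIntegrand (n + 2) γ p R u z) ^ (1 / p) := by
  have hp0 : 0 < p := by linarith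
  have hc : 0 < (γ - 1) / p := div_pos (by linarith) hp0
  have hL := lintegral_hardyGradIntegrand_lt_top hp hpγ hR hu hs
  have h := ENNReal.toReal_mono (ENNReal.mul_ne_top ENNReal.ofReal_ne_top hL.ne)
    (lintegral_hardyDiffIntegrand_le hγ hp hR hu)
  rw [ENNReal.toReal_mul, ← integral_hardyGradIntegrand _ _ _ _ hu,
    ← integral_hardyDiffIntegrand _ _ _ _ hu.continuous, ← inv_div,
    ENNReal.toReal_ofReal (by positivity), Real.inv_rpow hc.le] at h
  set D := ∫ z, hardyDiffIntegrand (n + 2) γ p R u z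
  have hD : 0 ≤ D := integral_nonneg (hardyDiffIntegrand_nonneg _ _ _ _ _)
  have h' : ((γ - 1) / p) ^ p * D ≤ ∫ z, hardyGradIntegrand (n + 2) γ p R u z := by
    rwa [← le_inv_mul_iff₀ (by positivity)]
  refine le_trans (le_of_eq ?_) (Real.rpow_le_rpow (by positivity) h' (by positivity))
  rw [Real.mul_rpow (by positivity) hD, ← Real.rpow_mul hc.le, mul_one_div_cancel hp0.ne',
    Real.rpow_one]

end estimates

section sharpness

lemma le_of_forall_mul_log_le {X Y m L₀ : ℝ} (hY : 0 ≤ Y)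
    (h : ∀ L, L₀ ≤ L → X * (L - m) ≤ Y * Real.log (exp L + 1)) : X ≤ Y := by
  by_contra! hlt
  have hXY : 0 < X - Y := sub_pos.2 hlt
  set L := max (max L₀ 0) ((Y + X * m) / (X - Y) + 1)
  have hL1 : L₀ ≤ L := (le_max_left _ _).trans (le_max_left _ _)
  have hL0 : 0 ≤ L := (le_max_right _ _).trans (le_max_left _ _)
  have hL2 : (Y + X * m) / (X - Y) + 1 ≤ L := le_max_right _ _
  have hlog : Real.log (exp L + 1) ≤ L + 1 := by
    rw [Real.log_le_iff_le_exp (by positivity), exp_add]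
    have h1 : 1 ≤ exp L := one_le_exp hL0
    have h2 : 2 ≤ exp 1 := by linarith [add_one_le_exp (1 : ℝ)]
    nlinarith
  have h1 := (h L hL1).trans (mul_le_mul_of_nonneg_left hlog hY)
  have h2 : (Y + X * m) / (X - Y) < L := by linarith
  rw [div_lt_iff₀ hXY] at h2
  nlinarith

/-- A smooth truncation of the power profile `t ↦ t ^ a`. -/
lemma exists_smooth_power_profile {a : ℝ} (ha : 0 < a) (N : ℝ) :
    ∃ f g : ℝ → ℝ, ContDiff ℝ (⊤ : ℕ∞) f ∧ Continuous g ∧ (∀ t, HasDerivAt f (g t) t) ∧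
      (∀ t ≤ 1, f t = 0) ∧ (∀ t, N + 1 ≤ t → f t = f (N + 1)) ∧
      (∀ t ∈ Set.Icc 1 (N + 1), |g t| ≤ a * t ^ (a - 1)) ∧
      (∀ t ∉ Set.Icc 1 (N + 1), g t = 0) ∧ ∀ t ∈ Set.Icc 2 N, t ^ a - 2 ^ a ≤ f t := by
  set g : ℝ → ℝ := fun t => a * t ^ (a - 1) *
    (Real.smoothTransition (t - 1) * Real.smoothTransition (N + 1 - t)) with hg
  have hst : ContDiff ℝ (⊤ : ℕ∞) Real.smoothTransition := Real.smoothTransition.contDiff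
  have hg_left : ∀ t ≤ 1, g t = 0 := fun t ht => by
    simp [hg, Real.smoothTransition.zero_of_nonpos (sub_nonpos.2 ht)]
  have hg_right : ∀ t, N + 1 ≤ t → g t = 0 := fun t ht => by
    simp [hg, Real.smoothTransition.zero_of_nonpos (sub_nonpos.2 ht)]
  have hgs : ContDiff ℝ (⊤ : ℕ∞) g := by
    rw [contDiff_iff_contDiffAt]
    intro t
    rcases lt_or_ge t 1 with ht | ht
    · refine (contDiffAt_const (c := (0 : ℝ))).congr_of_eventuallyEq ?_
      filter_upwards [Iio_mem_nhds ht] with s hs using hg_left s (le_of_lt hs)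
    · have h1 : ContDiffAt ℝ (⊤ : ℕ∞) (fun t : ℝ => t ^ (a - 1)) t :=
        Real.contDiffAt_rpow_const_of_ne (by linarith)
      have h2 : ContDiff ℝ (⊤ : ℕ∞) fun t : ℝ =>
          Real.smoothTransition (t - 1) * Real.smoothTransition (N + 1 - t) :=
        (hst.comp (by fun_prop)).mul (hst.comp (by fun_prop))
      exact (contDiffAt_const.mul h1).mul h2.contDiffAt
  have hgc := hgs.continuous
  have hd : ∀ t, HasDerivAt (fun t => ∫ s in (0 : ℝ)..t, g s) (g t) t := fun t =>
    intervalIntegral.integral_hasDerivAt_right (hgc.intervalIntegrable _ _)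
      (hgc.stronglyMeasurableAtFilter _ _) hgc.continuousAt
  have hg_nonneg : ∀ t, 0 ≤ t → 0 ≤ g t := fun t ht => by
    have h1 := Real.smoothTransition.nonneg (t - 1)
    have h2 := Real.smoothTransition.nonneg (N + 1 - t)
    simp only [hg]; positivity
  refine ⟨fun t => ∫ s in (0 : ℝ)..t, g s, g, ?_, hgc, hd, ?_, ?_, ?_, ?_, ?_⟩
  · rw [contDiff_infty_iff_deriv]
    refine ⟨fun t => (hd t).differentiableAt, ?_⟩
    rwa [show deriv (fun t => ∫ s in (0 : ℝ)..t, g s) = g from funext fun t => (hd t).deriv]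
  · intro t ht
    refine intervalIntegral.integral_zero_ae (ae_of_all _ fun s hs => hg_left s ?_)
    rw [Set.uIoc, Set.mem_Ioc] at hs
    exact hs.2.trans (max_le zero_le_one ht)
  · intro t ht
    simp only
    rw [← intervalIntegral.integral_add_adjacent_intervals (hgc.intervalIntegrable 0 (N + 1))
      (hgc.intervalIntegrable (N + 1) t), add_eq_left]
    refine intervalIntegral.integral_zero_ae (ae_of_all _ fun s hs => hg_right s ?_)
    rw [Set.uIoc_of_le ht] at hs
    exact hs.1.le
  · intro t ht
    have ht0 : 0 ≤ t := zero_le_one.trans ht.1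
    rw [abs_of_nonneg (hg_nonneg t ht0)]
    exact mul_le_of_le_one_right (by positivity) (mul_le_one₀ (Real.smoothTransition.le_one _)
      (Real.smoothTransition.nonneg _) (Real.smoothTransition.le_one _))
  · intro t ht
    rw [Set.mem_Icc, not_and_or, not_le, not_le] at ht
    exact ht.elim (fun h => hg_left t h.le) fun h => hg_right t h.le
  · intro t ht
    simp only
    have h0 : 0 ≤ ∫ s in (0 : ℝ)..2, g s :=
      intervalIntegral.integral_nonneg (by norm_num) fun s hs => hg_nonneg s hs.1
    have h1 : ∫ s in (2 : ℝ)..t, g s = t ^ a - 2 ^ a := by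
      have : ∫ s in (2 : ℝ)..t, g s = ∫ s in (2 : ℝ)..t, a * s ^ (a - 1) := by
        refine intervalIntegral.integral_congr fun s hs => ?_
        rw [Set.uIcc_of_le ht.1] at hs
        simp only [hg]
        rw [Real.smoothTransition.one_of_one_le (by linarith [hs.1]),
          Real.smoothTransition.one_of_one_le (by linarith [hs.2, ht.2]), mul_one, mul_one]
      rw [this, intervalIntegral.integral_const_mul, integral_rpow (Or.inl (by linarith)),
        sub_add_cancel, mul_div_cancel₀ _ ha.ne']
    rw [← intervalIntegral.integral_add_adjacent_intervals (hgc.intervalIntegrable 0 2)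
      (hgc.intervalIntegrable 2 t), h1]
    linarith

variable {n : ℕ}

/-- The radial test function with profile `f` in the variable `log ϱ`, shifted by `c`. -/
def logRadial (n : ℕ) (f : ℝ → ℝ) (c : ℝ) (z : GPt n) : ℝ := f (Real.log (gNorm z ^ 4) / 4) - c

lemma contDiff_logRadial {f : ℝ → ℝ} (hf : ContDiff ℝ (⊤ : ℕ∞) f) (h0 : ∀ t ≤ 1, f t = 0) (c : ℝ) :
    ContDiff ℝ (⊤ : ℕ∞) (logRadial n f c) := by
  have hH : ContDiff ℝ (⊤ : ℕ∞) fun q : ℝ => f (Real.log q / 4) := by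
    rw [contDiff_iff_contDiffAt]
    intro q
    by_cases hq : q = 0
    · refine (contDiffAt_const (c := (0 : ℝ))).congr_of_eventuallyEq ?_
      filter_upwards [Metric.ball_mem_nhds q one_pos] with s hs
      rw [hq, mem_ball_zero_iff, Real.norm_eq_abs] at hs
      refine h0 _ ?_
      have : Real.log s ≤ 0 := by
        rw [← Real.log_abs]; exact Real.log_nonpos (abs_nonneg s) hs.le
      linarith
    · exact hf.contDiffAt.comp q ((Real.contDiffAt_log.2 hq).div_const 4)
  have hP : ContDiff ℝ (⊤ : ℕ∞) fun z : GPt n => gNorm z ^ 4 := by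
    have : (fun z : GPt n => gNorm z ^ 4) = fun z => (‖z.1‖ ^ 2) ^ 2 + 4 * z.2 ^ 2 := by
      funext z; rw [gNorm_pow_four]; ring
    rw [this]
    have h1 : ContDiff ℝ (⊤ : ℕ∞) fun z : GPt n => ‖z.1‖ ^ 2 := contDiff_fst.norm_sq ℝ
    fun_prop
  exact (hH.comp hP).sub contDiff_const

lemma ray_logRadial {f : ℝ → ℝ} (c : ℝ) {z : GPt n} (hz : 0 < gNorm z) (t : ℝ) :
    ray 1 (logRadial n f c) z t = f t - c := by
  rw [ray, logRadial, gNorm_gDil (by positivity), div_mul_cancel₀ _ hz.ne', one_mul,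
    Real.log_pow, log_exp]
  norm_num

lemma hasCompactSupport_logRadial {f : ℝ → ℝ} {T c : ℝ} (hT : ∀ t, T ≤ t → f t = c) :
    HasCompactSupport (logRadial n f c) := by
  have hK : IsCompact {z : GPt n | gNorm z ≤ exp T} :=
    Metric.isCompact_of_isClosed_isBounded
      (isClosed_le continuous_gNorm continuous_const) (isBounded_gNorm_le _)
  refine HasCompactSupport.intro hK fun z hz => ?_
  have hz' : exp T < gNorm z := not_le.1 hz
  have h1 : T ≤ Real.log (gNorm z ^ 4) / 4 := by
    rw [Real.log_pow]
    have := (Real.lt_log_iff_exp_lt ((exp_pos T).trans hz')).2 hz'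
    push_cast
    linarith
  rw [logRadial, hT _ h1, sub_self]

lemma toReal_lintegral_gShell_pos (hn : 0 < n) {p : ℝ} (hp : 0 < p) :
    0 < (∫⁻ z in gShell n,
      ENNReal.ofReal (gPsi z ^ (p / 2) / gNorm z ^ (n + 2))).toReal := by
  have hm : Measurable fun z : GPt n => ENNReal.ofReal (gPsi z ^ (p / 2) / gNorm z ^ (n + 2)) := by
    have h1 := (continuous_gNorm (n := n)).measurable
    have h2 := measurable_gPsi (n := n)
    fun_prop
  refine ENNReal.toReal_pos (ne_of_gt ?_) (ne_of_lt ?_)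
  · rw [setLIntegral_pos_iff hm]
    set U : Set (GPt n) := {z | 1 < gNorm z ∧ gNorm z < exp 1 ∧ z.1 ≠ 0} with hU
    have hUo : IsOpen U :=
      (isOpen_lt continuous_const continuous_gNorm).inter
        ((isOpen_lt continuous_gNorm continuous_const).inter
          (isOpen_ne_fun continuous_fst continuous_const))
    have hUne : U.Nonempty := by
      refine ⟨(EuclideanSpace.single ⟨0, hn⟩ (2 : ℝ), 0), ?_⟩
      have h2 : gNorm ((EuclideanSpace.single ⟨0, hn⟩ (2 : ℝ), 0) : GPt n) = 2 := by
        refine (pow_left_inj₀ (gNorm_nonneg _) (by norm_num) (n := 4) (by norm_num)).1 ?_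
        rw [gNorm_pow_four]
        simp
      refine ⟨by rw [h2]; norm_num, by rw [h2]; linarith [exp_one_gt_d9], ?_⟩
      simp
    refine (hUo.measure_pos volume hUne).trans_le (measure_mono ?_)
    rintro z ⟨h1, h2, h3⟩
    refine ⟨?_, h1.le, h2⟩
    have h4 : 0 < ‖z.1‖ := norm_pos_iff.2 h3
    have h5 : 0 < gNorm z := by linarith
    have h6 : 0 < gPsi z := by unfold gPsi; positivity
    exact (ENNReal.ofReal_pos.2 (by positivity)).ne'
  · refine (setLIntegral_mono' (g := fun _ => 1) measurableSet_gShell fun z hz => ?_).trans_lt ?_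
    · rw [ENNReal.ofReal_le_one]
      refine div_le_one_of_le₀ ?_ (pow_nonneg (gNorm_nonneg z) _)
      exact (Real.rpow_le_one (gPsi_nonneg z) (gPsi_le_one z) (by positivity)).trans
        (one_le_pow₀ hz.1)
    · rw [setLIntegral_one]
      exact volume_gShell_lt_top

lemma lintegral_Icc_const_mul_inv {A M N : ℝ} (hA : 0 ≤ A) (hM : 0 < M) (hMN : M ≤ N) :
    ∫⁻ t in Set.Icc M N, ENNReal.ofReal (A * t⁻¹) =
      ENNReal.ofReal (A * (Real.log N - Real.log M)) := by
  have hi : IntervalIntegrable (fun t : ℝ => A * t⁻¹) volume M N := by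
    refine ContinuousOn.intervalIntegrable (ContinuousOn.mul continuousOn_const
      (ContinuousOn.inv₀ continuousOn_id fun t ht => ?_))
    rw [Set.uIcc_of_le hMN] at ht
    exact (hM.trans_le ht.1).ne'
  rw [← setLIntegral_congr Ioc_ae_eq_Icc, ← ofReal_integral_eq_lintegral_ofReal
    ((intervalIntegrable_iff_integrableOn_Ioc_of_le hMN).1 hi)
    ((ae_restrict_iff' measurableSet_Ioc).2 (ae_of_all _ fun t ht => by
      have : 0 < t := hM.trans ht.1
      simp only [Pi.zero_apply]; positivity)),
    ← intervalIntegral.integral_of_le hMN, intervalIntegral.integral_const_mul,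
    integral_inv_of_pos hM (hM.trans_le hMN), Real.log_div (hM.trans_le hMN).ne' hM.ne']

/-- Any constant admissible in the Hardy inequality is nearly bounded by `(γ - 1) / p`, with the
loss quantified by the truncation scale `N` of the almost extremal profile. -/
lemma hardy_const_log_bound (hn : 0 < n) {γ p κ δ M N : ℝ} (hγ : 1 < γ) (hp : 1 < p) (hκ : 0 < κ)
    (hδ1 : δ < 1) (hM : 2 ≤ M) (hMN : M ≤ N)
    (hMδ : ∀ t, M ≤ t → 2 ^ ((γ - 1) / p) ≤ δ * t ^ ((γ - 1) / p))
    (h : ∀ u : GPt n → ℝ, IsTest Set.univ u →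
      κ * (∫ z, hardyDiffIntegrand (n + 2) γ p 1 u z) ^ (1 / p) ≤
        (∫ z, hardyGradIntegrand (n + 2) γ p 1 u z) ^ (1 / p)) :
    (κ * (1 - δ)) ^ p * (Real.log N - Real.log M) ≤ ((γ - 1) / p) ^ p * Real.log (N + 1) := by
  have hp0 : 0 < p := by linarith
  set a := (γ - 1) / p with ha
  have ha0 : 0 < a := div_pos (by linarith) hp0
  have haγ : a * p = γ - 1 := div_mul_cancel₀ _ hp0.ne'
  obtain ⟨f, g, hf, hgc, hd, hf0, hfN, hgle, hg0, hfle⟩ :=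
    exists_smooth_power_profile ha0 N
  set u := logRadial n f (f (N + 1))
  have hu : ContDiff ℝ (⊤ : ℕ∞) u := contDiff_logRadial hf hf0 _
  have hs : HasCompactSupport u := hasCompactSupport_logRadial hfN
  have hray : ∀ z ∈ gShell n, ray 1 u z = fun t => f t - f (N + 1) := fun z hz =>
    funext (ray_logRadial _ (gNorm_pos_of_mem_gShell hz))
  set W := ∫⁻ z in gShell n, ENNReal.ofReal (gPsi z ^ (p / 2) / gNorm z ^ (n + 2)) with hW
  set IG := ∫⁻ t, ENNReal.ofReal (|t| ^ (p - γ) * |g t| ^ p) with hIG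
  set ID := ∫⁻ t, ENNReal.ofReal (|t| ^ (-γ) * |f t| ^ p) with hID
  have hm : Measurable fun z : GPt n => ENNReal.ofReal (gPsi z ^ (p / 2) / gNorm z ^ (n + 2)) := by
    have h1 := (continuous_gNorm (n := n)).measurable
    have h2 := measurable_gPsi (n := n)
    fun_prop
  have hG : ∫ z, hardyGradIntegrand (n + 2) γ p 1 u z = W.toReal * IG.toReal := by
    rw [integral_hardyGradIntegrand _ _ _ _ hu, lintegral_hardyGradIntegrand γ p one_pos hu,
      ← ENNReal.toReal_mul, hW, ← lintegral_mul_const _ hm]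
    congr 1
    refine setLIntegral_congr_fun measurableSet_gShell fun z hz => ?_
    have : ∀ t, deriv (fun t => f t - f (N + 1)) t = g t := fun t => ((hd t).sub_const _).deriv
    simp only [hray z hz, this, hIG]
  have hD : ∫ z, hardyDiffIntegrand (n + 2) γ p 1 u z = W.toReal * ID.toReal := by
    rw [integral_hardyDiffIntegrand _ _ _ _ hu.continuous,
      lintegral_hardyDiffIntegrand γ p one_pos hu.continuous,
      ← ENNReal.toReal_mul, hW, ← lintegral_mul_const _ hm]
    congr 1
    refine setLIntegral_congr_fun measurableSet_gShell fun z hz => ?_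
    simp only [hray z hz, hf0 0 zero_le_one, sub_sub_sub_cancel_right, sub_zero, hID]
  have hIGle : IG ≤ ENNReal.ofReal (a ^ p * Real.log (N + 1)) := by
    have hlog := lintegral_Icc_const_mul_inv (A := a ^ p) (by positivity) one_pos
      (by linarith : 1 ≤ N + 1)
    rw [Real.log_one, sub_zero] at hlog
    rw [← hlog, hIG, ← lintegral_indicator measurableSet_Icc]
    refine lintegral_mono fun t => ?_
    by_cases ht : t ∈ Set.Icc 1 (N + 1)
    · rw [Set.indicator_of_mem ht]
      have ht0 : 0 < t := zero_lt_one.trans_le ht.1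
      refine ENNReal.ofReal_le_ofReal ((mul_le_mul_of_nonneg_left (Real.rpow_le_rpow
        (abs_nonneg _) (hgle t ht) hp0.le) (by positivity)).trans_eq ?_)
      rw [abs_of_pos ht0, Real.mul_rpow ha0.le (by positivity), ← Real.rpow_mul ht0.le,
        mul_left_comm, ← Real.rpow_add ht0, ← Real.rpow_neg_one]
      congr 2
      linarith
    · rw [hg0 t ht, abs_zero, Real.zero_rpow hp0.ne']
      simp
  have hIDge : ENNReal.ofReal ((1 - δ) ^ p * (Real.log N - Real.log M)) ≤ ID := by
    rw [← lintegral_Icc_const_mul_inv (Real.rpow_nonneg (by linarith) _) (by linarith) hMN,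
      hID]
    refine le_trans ?_ (setLIntegral_le_lintegral (Set.Icc M N) _)
    refine setLIntegral_mono' measurableSet_Icc fun t ht => ENNReal.ofReal_le_ofReal ?_
    have ht0 : 0 < t := by linarith [ht.1]
    have h1 := hfle t ⟨hM.trans ht.1, ht.2⟩
    have h2 := hMδ t ht.1
    have h3 : (1 - δ) * t ^ a ≤ |f t| := le_trans (by linarith) (le_abs_self _)
    have h4 : 0 ≤ 1 - δ := by linarith
    refine le_trans (le_of_eq ?_) (mul_le_mul_of_nonneg_left (Real.rpow_le_rpow
      (by positivity) h3 hp0.le) (by positivity))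
    rw [abs_of_pos ht0, Real.mul_rpow h4 (by positivity), ← Real.rpow_mul ht0.le,
      mul_left_comm, ← Real.rpow_add ht0, ← Real.rpow_neg_one]
    congr 2
    linarith
  have hIGtop : IG ≠ ⊤ := ne_top_of_le_ne_top ENNReal.ofReal_ne_top hIGle
  have hIDtop : ID ≠ ⊤ := ne_top_of_le_ne_top
    (ENNReal.mul_ne_top ENNReal.ofReal_ne_top hIGtop)
    (lintegral_hardy hd hgc (hf0 0 zero_le_one) hp hγ)
  have hWpos : 0 < W.toReal := toReal_lintegral_gShell_pos hn hp0
  have hNpos : 0 < N + 1 := by linarith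
  have hG' : IG.toReal ≤ a ^ p * Real.log (N + 1) :=
    ENNReal.toReal_le_of_le_ofReal (mul_nonneg (by positivity) (Real.log_nonneg (by linarith)))
      hIGle
  have hD' : (1 - δ) ^ p * (Real.log N - Real.log M) ≤ ID.toReal :=
    (ENNReal.ofReal_le_iff_le_toReal hIDtop).1 hIDge
  have hκu := h u ⟨hu, hs, Set.subset_univ _⟩
  rw [hG, hD] at hκu
  have h1 := Real.rpow_le_rpow (by positivity) hκu hp0.le
  rw [Real.mul_rpow hκ.le (by positivity), ← Real.rpow_mul (by positivity),
    ← Real.rpow_mul (by positivity), one_div_mul_cancel hp0.ne', Real.rpow_one, Real.rpow_one,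
    mul_left_comm] at h1
  have h2 := le_of_mul_le_mul_left h1 hWpos
  rw [Real.mul_rpow hκ.le (by linarith), mul_assoc]
  exact (mul_le_mul_of_nonneg_left hD' (by positivity)).trans (h2.trans hG')

lemma hardy_const_le (hn : 0 < n) {γ p κ : ℝ} (hγ : 1 < γ) (hp : 1 < p)
    (h : ∀ u : GPt n → ℝ, IsTest Set.univ u →
      κ * (∫ z, hardyDiffIntegrand (n + 2) γ p 1 u z) ^ (1 / p) ≤
        (∫ z, hardyGradIntegrand (n + 2) γ p 1 u z) ^ (1 / p)) :
    κ ≤ (γ - 1) / p := by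
  have hp0 : 0 < p := by linarith
  have ha0 : 0 < (γ - 1) / p := div_pos (by linarith) hp0
  rcases le_or_gt κ 0 with hκ | hκ
  · exact hκ.trans ha0.le
  have hδ : ∀ δ : ℝ, 0 < δ → δ < 1 → κ * (1 - δ) ≤ (γ - 1) / p := by
    intro δ hδ0 hδ1
    set a := (γ - 1) / p with ha
    set M := 2 * (1 / δ) ^ (1 / a) with hM
    have h1δ : 1 ≤ 1 / δ := (one_le_div hδ0).2 hδ1.le
    have hM2 : 2 ≤ M := by
      have := Real.one_le_rpow h1δ (by positivity : 0 ≤ 1 / a)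
      linarith
    have hMδ : ∀ t, M ≤ t → 2 ^ a ≤ δ * t ^ a := by
      intro t ht
      have h1 : M ^ a ≤ t ^ a := Real.rpow_le_rpow (by linarith) ht ha0.le
      have h2 : δ * M ^ a = 2 ^ a := by
        rw [hM, Real.mul_rpow (by norm_num) (by positivity), ← Real.rpow_mul (by positivity),
          one_div_mul_cancel ha0.ne', Real.rpow_one]
        field_simp
      rw [← h2]
      exact mul_le_mul_of_nonneg_left h1 hδ0.le
    have hpow : (κ * (1 - δ)) ^ p ≤ a ^ p := by
      refine le_of_forall_mul_log_le (m := Real.log M) (L₀ := Real.log M) (by positivity)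
        fun L hL => ?_
      have hMN : M ≤ exp L := (Real.log_le_iff_le_exp (by linarith)).1 hL
      have := hardy_const_log_bound hn hγ hp hκ hδ1 hM2 hMN hMδ h
      rwa [Real.log_exp] at this
    exact (Real.rpow_le_rpow_iff (mul_nonneg hκ.le (by linarith)) ha0.le hp0).1 hpow
  by_contra! hlt
  have hd1 : 0 < 1 - (γ - 1) / p / κ := by rw [sub_pos, div_lt_one hκ]; exact hlt
  have hd2 : (γ - 1) / p / κ > 0 := by positivity
  have := hδ ((1 - (γ - 1) / p / κ) / 2) (by linarith) (by linarith)
  have h3 : κ * ((γ - 1) / p / κ) = (γ - 1) / p := mul_div_cancel₀ _ hκ.ne'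
  nlinarith

end sharpness

/-- Hardy inequality for the difference of a function and its scaled version,
with the sharp constant `(γ−1)/p` (Theorem 3.1 of the paper). -/
theorem diff_critical_hardy
    (n : ℕ) (Q : ℝ) (hQ : Q = n + 2) (hQ4 : 4 ≤ Q) (γ p : ℝ)
    (hγ : 1 < γ) (hp : max 1 (γ - 1) < p) :
    (∀ u : GPt n → ℝ, IsTest Set.univ u → ∀ R : ℝ, 0 < R →
      (∫ z : GPt n,
          gNorm z ^ (p - Q) * |Real.log (R / gNorm z)| ^ (p - γ) *
            (gPsi z ^ (p / 2) * |radialDeriv u z| ^ p)) ^ (1 / p)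
        ≥ (γ - 1) / p *
          (∫ z : GPt n,
              |u z - uScaled R u z| ^ p * gPsi z ^ (p / 2) /
                (gNorm z ^ Q * |Real.log (R / gNorm z)| ^ γ)) ^ (1 / p))
    ∧ ∀ κ : ℝ,
        (∀ u : GPt n → ℝ, IsTest Set.univ u → ∀ R : ℝ, 0 < R →
          (∫ z : GPt n,
              gNorm z ^ (p - Q) * |Real.log (R / gNorm z)| ^ (p - γ) *
                (gPsi z ^ (p / 2) * |radialDeriv u z| ^ p)) ^ (1 / p)
            ≥ κ *
              (∫ z : GPt n,
                  |u z - uScaled R u z| ^ p * gPsi z ^ (p / 2) /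
                    (gNorm z ^ Q * |Real.log (R / gNorm z)| ^ γ)) ^ (1 / p)) →
        κ ≤ (γ - 1) / p := by
  subst hQ
  obtain ⟨hp1, hpγ⟩ := max_lt_iff.1 hp
  have hn : 0 < n := by
    have : (2 : ℝ) ≤ n := by linarith
    exact_mod_cast (by linarith : (0 : ℝ) < n)
  exact ⟨fun u hu R hR => hardy_diff_le hγ hp1 hpγ hR hu.1 hu.2.1,
    fun κ hκ => hardy_const_le hn hγ hp1 fun u hu => hκ u hu 1 one_pos⟩
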